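/- arXiv:0705.1595 — 2 statements merged into one kernel-verified Lean document; each statement's English description precedes it below -/
import Mathlib

section
/- Let f_W : S^V → S^W be a sufficiently large finite-dimensional ℤ₂×S¹-equivariant approximation of the monopole map for a 4-manifold X with ℤ₂-action lifted to a Spin^c structure c with b₁=0, b₊≥1, b₊^{ℤ₂}≥1 and d(c)=1, and let n = cell-dim S^V for a fixed ℤ₂×S¹-CW structure on (S^V, *). If 2k₊ < 1 + b₊^{ℤ₂} and 2k₋ < 1 + b₊^{ℤ₂}, then the Bredon cochain groups C^k_{ℤ₂×S¹}(S^V, *; π̲_k(S^W)) vanish for all k ≤ n − 2. -/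
/-!
# Statement 11 (Lemma 4.2 of Nakamura, "Bauer-Furuta invariants under ℤ₂-actions")

Let `f_W : S^V → S^W` be a sufficiently large finite-dimensional `ℤ₂×S¹`-equivariant
approximation of the monopole map for a 4-manifold `X` with ℤ₂-action lifted to a Spin^c
structure `c` with `b₁ = 0`, `b₊ ≥ 1`, `b₊^{ℤ₂} ≥ 1` and `d(c) = 1`, and let
`n = cell-dim S^V` for a fixed `ℤ₂×S¹`-CW structure on `(S^V, *)`.  If
`2k₊ < 1 + b₊^{ℤ₂}` and `2k₋ < 1 + b₊^{ℤ₂}`, then the Bredon cochain groups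
`C^k_{ℤ₂×S¹}(S^V, *; π̲_k(S^W))` vanish for all `k ≤ n − 2`.

We realize the group `G = ℤ₂ × S¹`, the representations
`V = v₊ℂ₊ ⊕ v₋ℂ₋ ⊕ v_ℝ ℝ₊` (by Proposition 2.2, `V` contains no `ℝ₋`) and
`W = w₊ℂ₊ ⊕ w₋ℂ₋ ⊕ w_ℝ₊ ℝ₊ ⊕ w_ℝ₋ ℝ₋`, the one-point compactification `S^W` with its
`G`-action, and the fixed point sets `(S^W)^H` concretely; here `k₊ = v₊ − w₊` and
`k₋ = v₋ − w₋`, and `W_ℝ = V_ℝ ⊕ H⁺` gives `w_ℝ₊ = v_ℝ + b₊^{ℤ₂}` and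
`w_ℝ₋ = b₊ − b₊^{ℤ₂}`.  The `ℤ₂×S¹`-CW structure on `(S^V, *)` cannot be constructed in
Mathlib, so it is recorded abstractly: its `k`-cells `σ ≅ G/H_σ × D^k` with isotropy
groups `H_σ ∈ Iso(S^V,*) = {{e}, ℤ₂, ℤ̃₂, {1}×S¹, ℤ₂×S¹}` and the dimension bounds
`k ≤ cell-dim (S^V)^{H_σ}` imposed by the CW structure.  By Corollary 3.9, a Bredon
`k`-cochain is a function assigning to each `k`-cell `σ` an element of
`π̲_k(S^W)(G/H_σ) = π_k((S^W)^{H_σ})` (based at `∞`), so the cochain group is the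
dependent product over the `k`-cells, and its vanishing is `Subsingleton`.
-/

open OnePoint
open scoped Topology

noncomputable section

/-- The group `ℤ₂`, written multiplicatively. -/
abbrev Ztwo : Type := Multiplicative (ZMod 2)

/-- The group `G = ℤ₂ × S¹`. -/
abbrev GZ2S1 : Type := Ztwo × Circle

/-- The sign character of `ℤ₂`: the generator acts by `−1`. -/
def sgn (g : Ztwo) : ℝ := if g.toAdd = 0 then 1 else -1

/-- The real `ℤ₂×S¹`-representation `pℂ₊ ⊕ qℂ₋ ⊕ rℝ₊ ⊕ sℝ₋`. -/
abbrev RepSpace (p q r s : ℕ) : Type :=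
  (Fin p → ℂ) × (Fin q → ℂ) × (Fin r → ℝ) × (Fin s → ℝ)

@[simp] lemma sgn_one : sgn 1 = 1 := by simp [sgn]

lemma sgn_mul (g h : Ztwo) : sgn (g * h) = sgn g * sgn h := by
  have hcases : ∀ x : ZMod 2, x = 0 ∨ x = 1 := by decide
  have h11 : (1 + 1 : ZMod 2) = 0 := by decide
  have h10 : (1 : ZMod 2) ≠ 0 := by decide
  unfold sgn
  rw [toAdd_mul]
  rcases hcases g.toAdd with hg | hg <;> rcases hcases h.toAdd with hh | hh <;>
    simp [hg, hh, h11, h10]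

instance (p q r s : ℕ) : SMul GZ2S1 (RepSpace p q r s) where
  smul g v :=
    ⟨fun i => (g.2 : ℂ) * v.1 i,
     fun i => (sgn g.1 : ℂ) * ((g.2 : ℂ) * v.2.1 i),
     v.2.2.1,
     fun i => sgn g.1 * v.2.2.2 i⟩

instance (p q r s : ℕ) : MulAction GZ2S1 (RepSpace p q r s) where
  one_smul v := by
    refine Prod.ext ?_ (Prod.ext ?_ (Prod.ext ?_ ?_))
    · funext i; show ((1 : Circle) : ℂ) * v.1 i = v.1 i; simp
    · funext i
      show ((sgn 1 : ℝ) : ℂ) * (((1 : Circle) : ℂ) * v.2.1 i) = v.2.1 i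
      simp
    · rfl
    · funext i; show sgn 1 * v.2.2.2 i = v.2.2.2 i; simp
  mul_smul a b v := by
    refine Prod.ext ?_ (Prod.ext ?_ (Prod.ext ?_ ?_))
    · funext i
      show (((a.2 * b.2 : Circle)) : ℂ) * v.1 i = (a.2 : ℂ) * ((b.2 : ℂ) * v.1 i)
      push_cast; ring
    · funext i
      show ((sgn (a.1 * b.1) : ℝ) : ℂ) * (((a.2 * b.2 : Circle) : ℂ) * v.2.1 i) =
        ((sgn a.1 : ℝ) : ℂ) * ((a.2 : ℂ) * (((sgn b.1 : ℝ) : ℂ) * ((b.2 : ℂ) * v.2.1 i)))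
      rw [sgn_mul]; push_cast; ring
    · rfl
    · funext i
      show sgn (a.1 * b.1) * v.2.2.2 i = sgn a.1 * (sgn b.1 * v.2.2.2 i)
      rw [sgn_mul]; ring

/-- The induced action on the one-point compactification `S^W = OnePoint W`,
fixing the base point `∞`. -/
instance (p q r s : ℕ) : MulAction GZ2S1 (OnePoint (RepSpace p q r s)) where
  smul g x := OnePoint.map (g • ·) x
  one_smul x := by
    show OnePoint.map ((1 : GZ2S1) • ·) x = x
    have h : ((1 : GZ2S1) • · : RepSpace p q r s → RepSpace p q r s) = id := by
      funext v; simp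
    rw [h, OnePoint.map_id]; rfl
  mul_smul a b x := by
    show OnePoint.map ((a * b) • ·) x =
      OnePoint.map (a • ·) (OnePoint.map (b • ·) x)
    have h : ((a * b) • · : RepSpace p q r s → RepSpace p q r s) =
        (a • ·) ∘ (b • ·) := by
      funext v; simp [mul_smul]
    rw [h, OnePoint.map_comp]; rfl

/-- The element `−1` of the circle group. -/
def negCircle : Circle := ⟨(-1 : ℂ), by simp [Submonoid.unitSphere]⟩

/-- The subgroup `ℤ₂ ⊂ ℤ₂ × S¹` generated by `(−1, 1)`. -/
def Z2sub : Subgroup GZ2S1 := Subgroup.zpowers (Multiplicative.ofAdd (1 : ZMod 2), 1)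

/-- The subgroup `ℤ̃₂ ⊂ ℤ₂ × S¹` generated by `(−1, −1)`. -/
def Z2tildeSub : Subgroup GZ2S1 :=
  Subgroup.zpowers (Multiplicative.ofAdd (1 : ZMod 2), negCircle)

/-- The subgroup `{1} × S¹ ⊂ ℤ₂ × S¹`. -/
def S1sub : Subgroup GZ2S1 := (⊥ : Subgroup Ztwo).prod ⊤

/-- The fixed point set `(S^W)^H ⊆ S^W = OnePoint W` of a subgroup `H ≤ ℤ₂ × S¹`. -/
def fixedSet (p q r s : ℕ) (H : Subgroup GZ2S1) : Set (OnePoint (RepSpace p q r s)) :=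
  {x | ∀ h ∈ H, h • x = x}

/-- The base point `∞ ∈ (S^W)^H`. -/
def basePt (p q r s : ℕ) (H : Subgroup GZ2S1) : fixedSet p q r s H :=
  ⟨∞, fun _ _ => rfl⟩

/-- A fixed `ℤ₂×S¹`-CW structure on `(S^V, *)` for
`V = v₊ℂ₊ ⊕ v₋ℂ₋ ⊕ v_ℝ ℝ₊`, recorded through its cells: `cells k` is the set of
equivariant `k`-cells `σ ≅ G/H_σ × D^k`, with isotropy group `H_σ` belonging to
`Iso(S^V,*) = {{e}, ℤ₂, ℤ̃₂, {1}×S¹, ℤ₂×S¹}`; the cells of each isotropy type satisfy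
the dimension bounds `k ≤ cell-dim (S^V)^{H_σ}` forced by the CW structure
(the cell dimension of `(S^V)^H` is `dim (S^V)^H − 1` when `S¹` acts with
one-dimensional orbits on the stratum of isotropy `H`, i.e. for `H = {e}, ℤ₂, ℤ̃₂`,
and `dim (S^V)^H` for `H ⊇ {1}×S¹`); `n` is the cell dimension of `S^V`. -/
structure EquivariantCWStructureOnSV (vCp vCm vR : ℕ) where
  /-- the cell dimension `n = cell-dim S^V` -/
  n : ℕ
  /-- the set of equivariant `k`-cells of `(S^V, *)` -/
  cells : ℕ → Type
  /-- the isotropy group `H_σ` of the cell `σ` (its orbit type is `G/H_σ`) -/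
  isotropy : ∀ {k}, cells k → Subgroup GZ2S1
  /-- every isotropy group belongs to `Iso(S^V, *)` -/
  isotropy_mem : ∀ {k} (σ : cells k),
    isotropy σ ∈ ({⊥, Z2sub, Z2tildeSub, S1sub, ⊤} : Set (Subgroup GZ2S1))
  /-- free cells: `k + 1 ≤ dim S^V = 2v₊ + 2v₋ + v_ℝ` -/
  dim_free : ∀ {k} (σ : cells k), isotropy σ = ⊥ → k + 1 ≤ 2 * vCp + 2 * vCm + vR
  /-- cells of isotropy `ℤ₂`: `k + 1 ≤ dim (S^V)^{ℤ₂} = 2v₊ + v_ℝ` -/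
  dim_Z2 : ∀ {k} (σ : cells k), isotropy σ = Z2sub → k + 1 ≤ 2 * vCp + vR
  /-- cells of isotropy `ℤ̃₂`: `k + 1 ≤ dim (S^V)^{ℤ̃₂} = 2v₋ + v_ℝ` -/
  dim_Z2tilde : ∀ {k} (σ : cells k), isotropy σ = Z2tildeSub → k + 1 ≤ 2 * vCm + vR
  /-- cells of isotropy `{1}×S¹`: `k ≤ dim (S^V)^{S¹} = v_ℝ` -/
  dim_S1 : ∀ {k} (σ : cells k), isotropy σ = S1sub → k ≤ vR
  /-- cells of isotropy `ℤ₂×S¹`: `k ≤ dim (S^V)^{ℤ₂×S¹} = v_ℝ` -/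
  dim_top : ∀ {k} (σ : cells k), isotropy σ = ⊤ → k ≤ vR
  /-- `n` is the top cell dimension -/
  no_cells_above : ∀ k, n < k → IsEmpty (cells k)
  /-- there is a cell in dimension `n` -/
  top_cell : Nonempty (cells n)

section SphereHomotopy

open Filter Set Module

variable {E : Type*} [NormedAddCommGroup E]

section ProperSpace

variable [ProperSpace E]

lemma hasBasis_nhds_infty_norm :
    (𝓝 (∞ : OnePoint E)).HasBasis (fun _ : ℝ => True) fun R => {z | ∀ y : E, z = y → R < ‖y‖} := by
  refine (OnePoint.hasBasis_nhds_infty (X := E)).to_hasBasis ?_ ?_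
  · rintro s ⟨-, hs⟩
    obtain ⟨R, hR⟩ := hs.isBounded.exists_norm_le
    refine ⟨R, trivial, fun z hz => ?_⟩
    induction z using OnePoint.rec with
    | infty => exact Or.inr rfl
    | coe y => exact Or.inl ⟨y, fun hy => (hz y rfl).not_ge (hR y hy), rfl⟩
  · intro R _
    refine ⟨Metric.closedBall 0 R, ⟨Metric.isClosed_closedBall, isCompact_closedBall 0 R⟩, ?_⟩
    rintro z (⟨w, hw, rfl⟩ | rfl) y hy
    · obtain rfl := OnePoint.coe_injective hy
      simpa using hw
    · exact absurd hy (OnePoint.infty_ne_coe y)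

lemma tendsto_infty_of_norm {α : Type*} {l : Filter α} {F : α → OnePoint E}
    (h : ∀ R : ℝ, ∀ᶠ a in l, ∀ y : E, F a = y → R < ‖y‖) : Tendsto F l (𝓝 ∞) :=
  hasBasis_nhds_infty_norm.tendsto_right_iff.2 fun R _ => h R

lemma eventually_nhds_infty_norm (R : ℝ) :
    ∀ᶠ z : OnePoint E in 𝓝 ∞, ∀ y : E, z = y → R < ‖y‖ :=
  hasBasis_nhds_infty_norm.mem_of_mem trivial

lemma continuous_onePoint_translate :
    Continuous fun q : OnePoint E × E => OnePoint.map (· + q.2) q.1 := by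
  rw [continuous_iff_continuousAt]
  rintro ⟨z, v⟩
  induction z using OnePoint.rec with
  | coe y =>
    have := (OnePoint.isOpenEmbedding_coe (X := E)).prodMap (Topology.IsOpenEmbedding.id (X := E))
    refine (this.continuousAt_iff (x := (y, v))).1 ?_
    exact (OnePoint.continuous_coe.comp (continuous_fst.add continuous_snd)).continuousAt
  | infty =>
    refine tendsto_infty_of_norm fun R => ?_
    rw [nhds_prod_eq]
    filter_upwards [(eventually_nhds_infty_norm (R + (‖v‖ + 1))).prod_mk
      ((continuous_norm.tendsto v).eventually (gt_mem_nhds (lt_add_one ‖v‖)))]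
    rintro ⟨z, w⟩ ⟨hz, hw⟩ y hy
    induction z using OnePoint.rec with
    | infty => exact absurd hy (OnePoint.infty_ne_coe y)
    | coe u =>
      obtain rfl := OnePoint.coe_injective hy
      have h₁ := hz u rfl
      have h₂ := norm_sub_le (u + w) w
      rw [add_sub_cancel_right] at h₂
      dsimp only at h₁ hw h₂ ⊢
      linarith

lemma continuousAt_infty_elim_zero {u : E → E} (hu : ∀ y, ‖u y‖ ≤ ‖y‖⁻¹) :
    ContinuousAt (fun z : OnePoint E => z.elim 0 u) ∞ := by
  rw [ContinuousAt, OnePoint.elim_infty, Metric.tendsto_nhds]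
  intro ε hε
  filter_upwards [eventually_nhds_infty_norm ε⁻¹] with z hz
  induction z using OnePoint.rec with
  | infty => simpa using hε
  | coe y =>
    rw [OnePoint.elim_some, dist_zero_right]
    exact (hu y).trans_lt (inv_lt_of_inv_lt₀ hε (hz y rfl))

end ProperSpace

variable [NormedSpace ℝ E]

/-- A continuous map `S^E → E` that is the identity on the unit ball. -/
def onePointTruncate (z : OnePoint E) : E :=
  z.elim 0 fun y => (max 1 (‖y‖ ^ 2))⁻¹ • y

lemma onePointTruncate_coe {y : E} (hy : ‖y‖ ≤ 1) : onePointTruncate (y : OnePoint E) = y := by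
  have : ‖y‖ ^ 2 ≤ 1 := pow_le_one₀ (norm_nonneg y) hy
  simp [onePointTruncate, max_eq_left this]

lemma norm_inv_smul_le {a : ℝ} (y : E) (ha : ‖y‖ ^ 2 ≤ a) : ‖a⁻¹ • y‖ ≤ ‖y‖⁻¹ := by
  rcases eq_or_ne y 0 with rfl | hy
  · simp
  have hy' : 0 < ‖y‖ := norm_pos_iff.2 hy
  have ha' : 0 < a := (pow_pos hy' 2).trans_le ha
  rw [norm_smul, norm_inv, Real.norm_of_nonneg ha'.le, inv_mul_le_iff₀ ha', ← div_eq_mul_inv,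
    le_div_iff₀ hy', ← sq]
  exact ha

/-- The inversion `S^E → E`, with junk value `0` at `0`. -/
def onePointInversion (z : OnePoint E) : E :=
  z.elim 0 fun y => (‖y‖ ^ 2)⁻¹ • y

open Classical in
/-- The inversion `E → S^E`. -/
def inversionToOnePoint (v : E) : OnePoint E :=
  if v = 0 then ∞ else ((‖v‖ ^ 2)⁻¹ • v : E)

@[simp]
lemma inversionToOnePoint_zero : inversionToOnePoint (0 : E) = ∞ := if_pos rfl

lemma inversionToOnePoint_inversion {z : OnePoint E} (hz : z ≠ (0 : E)) :
    inversionToOnePoint (onePointInversion z) = z := by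
  induction z using OnePoint.rec with
  | infty => exact if_pos rfl
  | coe y =>
    have hy : y ≠ 0 := fun h => hz (h ▸ rfl)
    have hy' : ‖y‖ ≠ 0 := norm_ne_zero_iff.2 hy
    rw [onePointInversion, OnePoint.elim_some, inversionToOnePoint,
      if_neg (smul_ne_zero (by positivity) hy), smul_smul, norm_smul, norm_inv, norm_pow, norm_norm]
    congr 1
    convert! one_smul ℝ y using 2
    field_simp

variable [FiniteDimensional ℝ E]

lemma continuous_onePointTruncate : Continuous (onePointTruncate : OnePoint E → E) := by
  rw [continuous_iff_continuousAt]
  intro z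
  induction z using OnePoint.rec with
  | infty => exact continuousAt_infty_elim_zero fun y => norm_inv_smul_le y (le_max_right _ _)
  | coe y =>
    rw [OnePoint.continuousAt_coe]
    refine Continuous.continuousAt (Continuous.smul (Continuous.inv₀ (by fun_prop) fun x => ?_)
      continuous_id)
    positivity

lemma continuousAt_onePointInversion {z : OnePoint E} (hz : z ≠ (0 : E)) :
    ContinuousAt (onePointInversion : OnePoint E → E) z := by
  induction z using OnePoint.rec with
  | infty => exact continuousAt_infty_elim_zero fun y => norm_inv_smul_le y le_rfl
  | coe y =>
    have hy : y ≠ 0 := fun h => hz (h ▸ rfl)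
    rw [OnePoint.continuousAt_coe]
    exact ContinuousAt.smul (ContinuousAt.inv₀ (by fun_prop) (by positivity)) continuousAt_id

lemma continuous_inversionToOnePoint : Continuous (inversionToOnePoint : E → OnePoint E) := by
  rw [continuous_iff_continuousAt]
  intro v
  rcases eq_or_ne v 0 with rfl | hv
  · rw [ContinuousAt, inversionToOnePoint_zero]
    refine tendsto_infty_of_norm fun R => ?_
    filter_upwards [Metric.ball_mem_nhds (0 : E) (ε := (|R| + 1)⁻¹) (by positivity)] with w hw y hy
    rw [inversionToOnePoint] at hy
    split_ifs at hy with h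
    · exact absurd hy (OnePoint.infty_ne_coe y)
    · obtain rfl := OnePoint.coe_injective hy
      have hw' : 0 < ‖w‖ := norm_pos_iff.2 h
      rw [mem_ball_zero_iff] at hw
      have hR := lt_inv_of_lt_inv₀ hw' hw
      have : ‖(‖w‖ ^ 2)⁻¹ • w‖ = ‖w‖⁻¹ := by
        rw [norm_smul, norm_inv, norm_pow, norm_norm]
        field_simp
      rw [this]
      linarith [le_abs_self R]
  · refine ContinuousAt.congr (f := fun w : E => (((‖w‖ ^ 2)⁻¹ • w : E) : OnePoint E)) ?_ ?_
    · exact OnePoint.continuous_coe.continuousAt.comp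
        (ContinuousAt.smul (ContinuousAt.inv₀ (by fun_prop) (by positivity)) continuousAt_id)
    · filter_upwards [isOpen_ne.mem_nhds hv] with w hw
      exact (if_neg hw).symm

variable {k : ℕ}

/-- A continuous map from a `k`-cube to a Euclidean space of larger dimension can be approximated
by a continuous map whose range has dense complement. -/
lemma exists_approx_dense_compl_range (hk : k < finrank ℝ E) (g : C(Fin k → unitInterval, E))
    {ε : ℝ} (hε : 0 < ε) :
    ∃ p : C(Fin k → unitInterval, E), (∀ x, dist (p x) (g x) < ε) ∧ Dense (range p)ᶜ := by
  let r : (Fin k → ℝ) → Fin k → unitInterval := fun x i => projIcc 0 1 zero_le_one (x i)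
  have hr : Continuous r := by fun_prop
  obtain ⟨q, hq, hqg, -⟩ := (g.continuous.comp hr).exists_contDiff_approx 1
    (ε := fun _ => ε) continuous_const fun _ => hε
  refine ⟨⟨fun x => q fun i => x i, hq.continuous.comp (by fun_prop)⟩, fun x => ?_, ?_⟩
  · have hx : r (fun i => x i) = x := funext fun i => projIcc_val _ _
    simpa [hx] using hqg fun i => x i
  · refine (hq.dense_compl_range_of_finrank_lt_finrank (by simpa using hk)).mono ?_
    rw [compl_subset_compl]
    rintro _ ⟨x, rfl⟩
    exact ⟨_, rfl⟩

lemma GenLoop.homotopic_const_of_forall_ne_zero (f : GenLoop (Fin k) (OnePoint E) ∞)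
    (hf : ∀ x, f x ≠ (0 : E)) : GenLoop.Homotopic f GenLoop.const := by
  have hcont : Continuous fun x => onePointInversion (f x) :=
    continuous_iff_continuousAt.2 fun x =>
      (continuousAt_onePointInversion (hf x)).comp f.1.continuous.continuousAt
  refine ⟨⟨⟨⟨fun q => inversionToOnePoint ((1 - (q.1 : ℝ)) • onePointInversion (f q.2)),
    continuous_inversionToOnePoint.comp <|
      (by fun_prop : Continuous fun q : unitInterval × (Fin k → unitInterval) => 1 - (q.1 : ℝ)).smul
        (hcont.comp continuous_snd)⟩, fun x => ?_, fun x => ?_⟩, ?_⟩⟩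
  · simpa using inversionToOnePoint_inversion (hf x)
  · simp
  · intro t x hx
    have : f x = ∞ := f.2 x hx
    simp [this, onePointInversion]

/-- Every map from a `k`-cube to the sphere `S^E` with `k < dim E` is nullhomotopic relative to the
boundary. -/
lemma GenLoop.homotopic_const_of_lt_finrank (hk : k < finrank ℝ E)
    (f : GenLoop (Fin k) (OnePoint E) ∞) : GenLoop.Homotopic f GenLoop.const := by
  let g : C(Fin k → unitInterval, E) :=
    ⟨fun x => onePointTruncate (f x), continuous_onePointTruncate.comp f.1.continuous⟩
  obtain ⟨p, hpg, hp⟩ := exists_approx_dense_compl_range hk g (ε := 1 / 2) (by norm_num)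
  obtain ⟨c, hcp, hc⟩ := hp.exists_dist_lt 0 (ε := 1 / 2) (by norm_num)
  rw [dist_zero_left] at hc
  let H : C(unitInterval × (Fin k → unitInterval), OnePoint E) :=
    ⟨fun q => OnePoint.map (· + (q.1 : ℝ) • (p q.2 - g q.2 - c)) (f q.2),
      continuous_onePoint_translate.comp (f := fun q : unitInterval × (Fin k → unitInterval) =>
        (f q.2, (q.1 : ℝ) • (p q.2 - g q.2 - c)))
        ((f.1.continuous.comp continuous_snd).prodMk (by fun_prop))⟩
  have hH : ∀ t, ∀ x ∈ Cube.boundary (Fin k), H (t, x) = ∞ := fun t x hx => by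
    have : f x = ∞ := f.2 x hx
    simp [H, this]
  let f' : GenLoop (Fin k) (OnePoint E) ∞ := ⟨H.comp ⟨fun x => (1, x), by fun_prop⟩, hH 1⟩
  refine GenLoop.Homotopic.trans (g := f') ⟨⟨⟨H, fun x => ?_, fun x => rfl⟩, fun t x hx => ?_⟩⟩
    (GenLoop.homotopic_const_of_forall_ne_zero f' fun x hx => ?_)
  · change OnePoint.map (· + ((0 : unitInterval) : ℝ) • (p x - g x - c)) (f x) = f x
    rw [Set.Icc.coe_zero]
    simp_rw [zero_smul, add_zero]
    exact congrFun OnePoint.map_id (f x)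
  · exact (hH t x hx).trans (f.2 x hx).symm
  · change OnePoint.map (· + ((1 : unitInterval) : ℝ) • (p x - g x - c)) (f x) = (0 : E) at hx
    have hgx : g x = onePointTruncate (f x) := rfl
    generalize f x = z at hx hgx
    induction z using OnePoint.rec with
    | infty => exact OnePoint.infty_ne_coe _ hx
    | coe y =>
      have hy : y + (p x - g x - c) = 0 := by simpa using OnePoint.coe_injective hx
      rcases le_or_gt ‖y‖ 1 with h | h
      · rw [hgx, onePointTruncate_coe h] at hy
        exact hcp ⟨x, sub_eq_zero.1 (by rw [← hy]; abel)⟩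
      · have h₁ : y = c - (p x - g x) := by
          rw [← sub_eq_zero, ← hy]; abel
        have h₂ := norm_sub_le c (p x - g x)
        have h₃ := hpg x
        rw [dist_eq_norm] at h₃
        rw [← h₁] at h₂
        linarith

/-- `π_k(S^E) = 0` for `k < dim E`. -/
lemma subsingleton_homotopyGroup_of_homeomorph_onePoint {X : Type*} [TopologicalSpace X] {x₀ : X}
    (e : OnePoint E ≃ₜ X) (he : e ∞ = x₀) (hk : k < finrank ℝ E) :
    Subsingleton (HomotopyGroup (Fin k) X x₀) := by
  subst he
  suffices h : ∀ f : GenLoop (Fin k) X (e ∞), GenLoop.Homotopic f GenLoop.const by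
    refine ⟨fun a b => ?_⟩
    induction a using Quotient.inductionOn with | _ f
    induction b using Quotient.inductionOn with | _ f'
    exact Quotient.sound ((h f).trans (h f').symm)
  intro f
  obtain ⟨H⟩ := GenLoop.homotopic_const_of_lt_finrank hk
    (⟨(e.symm : C(X, OnePoint E)).comp f.1, fun x hx => by simp [f.2 x hx]⟩ :
      GenLoop (Fin k) (OnePoint E) ∞)
  refine ⟨⟨⟨⟨fun q => e (H q), by fun_prop⟩, fun x => ?_, fun x => ?_⟩, fun t x hx => ?_⟩⟩
  · simp
  · simp
  · have := H.eq_fst t hx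
    simp_all

end SphereHomotopy

section FixedPoints

open Module

variable {p q r s : ℕ}

lemma RepSpace.smul_def (g : GZ2S1) (v : RepSpace p q r s) :
    g • v = (fun i => (g.2 : ℂ) * v.1 i, fun i => (sgn g.1 : ℂ) * ((g.2 : ℂ) * v.2.1 i), v.2.2.1,
      fun i => sgn g.1 * v.2.2.2 i) := rfl

variable (p q r s) in
/-- The linear fixed point subspace `W^H` of a subgroup `H ≤ ℤ₂ × S¹`. -/
def fixedSubmodule (H : Subgroup GZ2S1) : Submodule ℝ (RepSpace p q r s) where
  carrier := {w | ∀ h ∈ H, h • w = w}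
  zero_mem' h _ := by
    rw [RepSpace.smul_def]
    refine Prod.ext ?_ (Prod.ext ?_ (Prod.ext rfl ?_)) <;> funext i <;> simp
  add_mem' {v w} hv hw h hh := by
    have : h • (v + w) = h • v + h • w := by
      simp only [RepSpace.smul_def]
      ext <;> simp <;> ring
    rw [this, hv h hh, hw h hh]
  smul_mem' c v hv h hh := by
    have : h • (c • v) = c • (h • v) := by
      simp only [RepSpace.smul_def]
      refine Prod.ext ?_ (Prod.ext ?_ (Prod.ext rfl ?_)) <;> funext i <;> simp <;> ring
    rw [this, hv h hh]

lemma finrank_le_finrank_fixedSubmodule {F : Type*} [AddCommGroup F] [Module ℝ F]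
    (H : Subgroup GZ2S1) (φ : F →ₗ[ℝ] RepSpace p q r s) (hφ : Function.Injective φ)
    (hfix : ∀ x, ∀ h ∈ H, h • φ x = φ x) : finrank ℝ F ≤ finrank ℝ (fixedSubmodule p q r s H) :=
  LinearMap.finrank_le_finrank_of_injective (f := φ.codRestrict (fixedSubmodule p q r s H) hfix)
    ((LinearMap.injective_codRestrict_iff ..).2 hφ)

lemma le_finrank_fixedSubmodule_bot :
    2 * p + 2 * q + r + s ≤ finrank ℝ (fixedSubmodule p q r s ⊥) := by
  refine le_trans (le_of_eq ?_) (finrank_le_finrank_fixedSubmodule (F := RepSpace p q r s) ⊥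
    LinearMap.id Function.injective_id fun x h hh => ?_)
  · simp [finrank_pi_fintype]
    ring
  · obtain rfl := Subgroup.mem_bot.1 hh
    exact one_smul _ _

lemma smul_eq_of_mem_zpowers {g h : GZ2S1} {w : RepSpace p q r s} (hg : g • w = w)
    (hh : h ∈ Subgroup.zpowers g) : h • w = w :=
  (Subgroup.zpowers_le (H := MulAction.stabilizer GZ2S1 w)).2 hg hh

lemma sgn_generator : sgn (Multiplicative.ofAdd (1 : ZMod 2)) = -1 := by
  simp [sgn]

lemma le_finrank_fixedSubmodule_Z2sub :
    2 * p + r ≤ finrank ℝ (fixedSubmodule p q r s Z2sub) := by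
  let φ : ((Fin p → ℂ) × (Fin r → ℝ)) →ₗ[ℝ] RepSpace p q r s :=
    (LinearMap.fst ℝ _ _).prod (LinearMap.prod 0 ((LinearMap.snd ℝ _ _).prod 0))
  have hφ (x) : φ x = (x.1, 0, x.2, 0) := rfl
  refine le_trans (le_of_eq ?_) (finrank_le_finrank_fixedSubmodule Z2sub φ
    (fun x y h => ?_) fun x h hh => smul_eq_of_mem_zpowers ?_ hh)
  · simp [finrank_pi_fintype]
    ring
  · simp only [hφ, Prod.mk.injEq] at h
    exact Prod.ext h.1 h.2.2.1
  · rw [hφ, RepSpace.smul_def]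
    refine Prod.ext ?_ (Prod.ext ?_ (Prod.ext rfl ?_)) <;> funext i <;> simp

lemma le_finrank_fixedSubmodule_Z2tildeSub :
    2 * q + r ≤ finrank ℝ (fixedSubmodule p q r s Z2tildeSub) := by
  let φ : ((Fin q → ℂ) × (Fin r → ℝ)) →ₗ[ℝ] RepSpace p q r s :=
    LinearMap.prod 0 ((LinearMap.fst ℝ _ _).prod ((LinearMap.snd ℝ _ _).prod 0))
  have hφ (x) : φ x = (0, x.1, x.2, 0) := rfl
  refine le_trans (le_of_eq ?_) (finrank_le_finrank_fixedSubmodule Z2tildeSub φ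
    (fun x y h => ?_) fun x h hh => smul_eq_of_mem_zpowers ?_ hh)
  · simp [finrank_pi_fintype]
    ring
  · simp only [hφ, Prod.mk.injEq] at h
    exact Prod.ext h.2.1 h.2.2.1
  · rw [hφ, RepSpace.smul_def]
    refine Prod.ext ?_ (Prod.ext ?_ (Prod.ext rfl ?_)) <;> funext i <;>
      simp [sgn_generator, negCircle]

lemma le_finrank_fixedSubmodule (H : Subgroup GZ2S1) :
    r ≤ finrank ℝ (fixedSubmodule p q r s H) := by
  let φ : (Fin r → ℝ) →ₗ[ℝ] RepSpace p q r s :=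
    LinearMap.prod 0 (LinearMap.prod 0 (LinearMap.prod LinearMap.id 0))
  have hφ (x) : φ x = (0, 0, x, 0) := rfl
  refine le_trans (le_of_eq ?_) (finrank_le_finrank_fixedSubmodule H φ (fun x y h => ?_)
    fun x h _ => ?_)
  · simp
  · simp only [hφ, Prod.mk.injEq] at h
    exact h.2.2.1
  · rw [hφ, RepSpace.smul_def]
    refine Prod.ext ?_ (Prod.ext ?_ (Prod.ext rfl ?_)) <;> funext i <;> simp

/-- The inclusion `S^(W^H) → (S^W)^H`. -/
def fixedSubmoduleToFixedSet (H : Subgroup GZ2S1) (z : OnePoint (fixedSubmodule p q r s H)) :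
    fixedSet p q r s H :=
  ⟨z.map Subtype.val, fun h hh => by
    induction z using OnePoint.rec with
    | infty => rfl
    | coe w => exact congrArg OnePoint.some (w.2 h hh)⟩

lemma continuous_fixedSubmoduleToFixedSet (H : Subgroup GZ2S1) :
    Continuous (fixedSubmoduleToFixedSet (p := p) (q := q) (r := r) (s := s) H) := by
  refine Continuous.subtype_mk (OnePoint.continuous_map continuous_subtype_val ?_) _
  rw [Filter.coclosedCompact_eq_cocompact, Filter.coclosedCompact_eq_cocompact]
  exact (fixedSubmodule p q r s H).closed_of_finiteDimensional.isClosedEmbedding_subtypeVal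
    |>.tendsto_cocompact

lemma bijective_fixedSubmoduleToFixedSet (H : Subgroup GZ2S1) :
    Function.Bijective (fixedSubmoduleToFixedSet (p := p) (q := q) (r := r) (s := s) H) := by
  refine ⟨fun z w h => Option.map_injective Subtype.val_injective (congrArg Subtype.val h), ?_⟩
  rintro ⟨z, hz⟩
  induction z using OnePoint.rec with
  | infty => exact ⟨∞, rfl⟩
  | coe w => exact ⟨((⟨w, fun h hh => OnePoint.coe_injective (hz h hh)⟩ :
      fixedSubmodule p q r s H) : OnePoint _), rfl⟩

/-- The identification `S^(W^H) ≃ₜ (S^W)^H`. -/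
def fixedSubmoduleHomeomorph (H : Subgroup GZ2S1) :
    OnePoint (fixedSubmodule p q r s H) ≃ₜ fixedSet p q r s H :=
  (continuous_fixedSubmoduleToFixedSet H).homeoOfEquivCompactToT2
    (f := Equiv.ofBijective _ (bijective_fixedSubmoduleToFixedSet H))

lemma subsingleton_homotopyGroup_fixedSet {H : Subgroup GZ2S1} {k : ℕ}
    (hk : k < finrank ℝ (fixedSubmodule p q r s H)) :
    Subsingleton (π_ k (fixedSet p q r s H) (basePt p q r s H)) :=
  subsingleton_homotopyGroup_of_homeomorph_onePoint (fixedSubmoduleHomeomorph H) rfl hk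

end FixedPoints

lemma EquivariantCWStructureOnSV.n_le {vCp vCm vR : ℕ}
    (cw : EquivariantCWStructureOnSV vCp vCm vR) :
    cw.n + 1 ≤ 2 * vCp + 2 * vCm + vR ∨ cw.n ≤ vR := by
  obtain ⟨σ⟩ := cw.top_cell
  rcases cw.isotropy_mem σ with h | h | h | h | h
  · exact Or.inl (cw.dim_free σ h)
  · have := cw.dim_Z2 σ h
    lia
  · have := cw.dim_Z2tilde σ h
    lia
  · exact Or.inr (cw.dim_S1 σ h)
  · exact Or.inr (cw.dim_top σ h)

/-- **Lemma 4.2.**  Let `V = v₊ℂ₊ ⊕ v₋ℂ₋ ⊕ v_ℝ ℝ₊` and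
`W = w₊ℂ₊ ⊕ w₋ℂ₋ ⊕ w_ℝ₊ℝ₊ ⊕ w_ℝ₋ℝ₋` be a (sufficiently large) finite-dimensional
approximation of the monopole map, so that `k₊ = v₊ − w₊`, `k₋ = v₋ − w₋`,
`w_ℝ₊ = v_ℝ + b₊^{ℤ₂}`, `w_ℝ₋ = b₊ − b₊^{ℤ₂}`, with `b₁ = 0`, `b₊ ≥ 1`, `b₊^{ℤ₂} ≥ 1`
and `d(c) = 2(k₊+k₋) − (1+b₊) = 1`.  If `2k₊ < 1 + b₊^{ℤ₂}` and `2k₋ < 1 + b₊^{ℤ₂}`,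
then for every `k ≤ n − 2` the Bredon cochain group
`C^k_{ℤ₂×S¹}(S^V, *; π̲_k(S^W)) = Π_{σ : k-cell} π_k((S^W)^{H_σ}, ∞)` vanishes. -/
theorem bredon_cochains_vanish_in_low_degrees
    (b1 bplus bplusZ2 vCp vCm vR wCp wCm wRp wRm : ℕ)
    (cw : EquivariantCWStructureOnSV vCp vCm vR)
    (hb1 : b1 = 0)
    (hbplus : 1 ≤ bplus)
    (hbplusZ2 : 1 ≤ bplusZ2)
    (hwRp : wRp = vR + bplusZ2)
    (hwRm : (wRm : ℤ) = (bplus : ℤ) - (bplusZ2 : ℤ))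
    (hd : 2 * (((vCp : ℤ) - (wCp : ℤ)) + ((vCm : ℤ) - (wCm : ℤ))) - (1 + (bplus : ℤ)) = 1)
    (hkplus : 2 * ((vCp : ℤ) - (wCp : ℤ)) < 1 + (bplusZ2 : ℤ))
    (hkminus : 2 * ((vCm : ℤ) - (wCm : ℤ)) < 1 + (bplusZ2 : ℤ))
    (k : ℕ) (hk : k + 2 ≤ cw.n) :
    Subsingleton
      ((σ : cw.cells k) →
        π_ k (fixedSet wCp wCm wRp wRm (cw.isotropy σ))
          (basePt wCp wCm wRp wRm (cw.isotropy σ))) := by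
  refine @Pi.instSubsingleton _ _ fun σ => subsingleton_homotopyGroup_fixedSet ?_
  have hn := cw.n_le
  rcases cw.isotropy_mem σ with h | h | h | h | h
  · have := le_finrank_fixedSubmodule_bot (p := wCp) (q := wCm) (r := wRp) (s := wRm)
    rw [h]
    lia
  · have := le_finrank_fixedSubmodule_Z2sub (p := wCp) (q := wCm) (r := wRp) (s := wRm)
    have := cw.dim_Z2 σ h
    rw [h]
    lia
  · have := le_finrank_fixedSubmodule_Z2tildeSub (p := wCp) (q := wCm) (r := wRp) (s := wRm)
    have := cw.dim_Z2tilde σ h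
    rw [h]
    lia
  · have := le_finrank_fixedSubmodule (p := wCp) (q := wCm) (r := wRp) (s := wRm) (cw.isotropy σ)
    have := cw.dim_S1 σ h
    lia
  · have := le_finrank_fixedSubmodule (p := wCp) (q := wCm) (r := wRp) (s := wRm) (cw.isotropy σ)
    have := cw.dim_top σ h
    lia

end
end

section
/- Let A be the symmetric 8×8 integer matrix with A_{ii} = 0 for 1 ≤ i ≤ 4, A_{ii} = 2 for 5 ≤ i ≤ 8, and A_{ij} = 1 for all i ≠ j. Then the bilinear form represented by A is even, unimodular and indefinite, and is isomorphic over ℤ to the orthogonal direct sum of four hyperbolic planes: there exists P ∈ GL(8, ℤ) such that Pᵀ A P is the block-diagonal matrix with four blocks ((0,1),(1,0)). -/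
open Matrix

/-!
# Statement 19 (the matrix `A` of equation (5.4) in Nakamura, "Bauer-Furuta invariants
under ℤ₂-actions")

Let `A` be the symmetric 8×8 integer matrix with `A_{ii} = 0` for `1 ≤ i ≤ 4`, `A_{ii} = 2`
for `5 ≤ i ≤ 8`, and `A_{ij} = 1` for all `i ≠ j`.  Then the bilinear form represented by
`A` is even, unimodular and indefinite, and is isomorphic over ℤ to the orthogonal direct
sum of four hyperbolic planes: there exists `P ∈ GL(8,ℤ)` with `Pᵀ A P` the block diagonal
matrix with four blocks `((0,1),(1,0))`.
-/

/-- The matrix `A` of equation (5.4): `A_{ii} = 0` for the first four indices, `A_{ii} = 2`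
for the last four, and all off-diagonal entries equal to `1`. -/
def matrixA : Matrix (Fin 8) (Fin 8) ℤ := fun i j =>
  if i = j then (if i.val < 4 then 0 else 2) else 1

/-- The orthogonal direct sum `4H` of four hyperbolic planes `H = ((0,1),(1,0))`, as an
8×8 integer matrix with blocks on the index pairs `(0,1), (2,3), (4,5), (6,7)`. -/
def fourHyperbolic : Matrix (Fin 8) (Fin 8) ℤ := fun i j =>
  if i.val / 2 = j.val / 2 ∧ i ≠ j then 1 else 0

/-- A quadratic form represented by `U + Uᵀ` takes only even values. -/
theorem even_dotProduct_add_transpose_mulVec {n : Type*} [Fintype n] (U : Matrix n n ℤ)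
    (v : n → ℤ) : Even (v ⬝ᵥ (U + Uᵀ).mulVec v) := by
  refine ⟨v ⬝ᵥ U.mulVec v, ?_⟩
  rw [add_mulVec, dotProduct_add, mulVec_transpose, dotProduct_comm v (v ᵥ* U),
    dotProduct_mulVec]

/-- The upper triangular matrix `U` with `matrixA = U + Uᵀ`. -/
def matrixAUpper : Matrix (Fin 8) (Fin 8) ℤ := fun i j =>
  if i < j ∨ (i = j ∧ 4 ≤ i.val) then 1 else 0

theorem matrixA_eq_upper_add_transpose : matrixA = matrixAUpper + matrixAUpperᵀ := by
  decide

/-- The matrix whose columns form a basis of hyperbolic pairs for `matrixA`. -/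
def hyperbolicBasis : Matrix (Fin 8) (Fin 8) ℤ :=
  !![1, 0, -1,  1,  1,  1, -1,  1;
     0, 1, -1,  1,  1,  1, -1,  1;
     0, 0,  0,  0,  1,  0, -1,  1;
     0, 0,  0,  0,  0,  1, -1,  1;
     0, 0,  1,  0, -1, -1,  1, -1;
     0, 0,  0, -1, -1, -1,  1, -1;
     0, 0,  0,  0,  0,  0,  1,  0;
     0, 0,  0,  0,  0,  0,  0, -1]

theorem hyperbolicBasis_transpose_mul_matrixA_mul :
    hyperbolicBasis.transpose * matrixA * hyperbolicBasis = fourHyperbolic := by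
  decide +kernel

theorem fourHyperbolic_mul_self : fourHyperbolic * fourHyperbolic = 1 := by
  decide +kernel

/-- The form `A` is even (all its diagonal values `vᵀAv` are even), unimodular
(`det A = ±1`) and indefinite (it takes both positive and negative values), and there is a
`P ∈ GL(8,ℤ)` with `Pᵀ A P = 4H`, the orthogonal sum of four hyperbolic planes. -/
theorem matrixA_isomorphic_to_four_hyperbolic_planes :
    (∀ v : Fin 8 → ℤ, Even (v ⬝ᵥ matrixA.mulVec v)) ∧
    IsUnit matrixA.det ∧
    (∃ v w : Fin 8 → ℤ, 0 < v ⬝ᵥ matrixA.mulVec v ∧ w ⬝ᵥ matrixA.mulVec w < 0) ∧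
    (∃ P : Matrix (Fin 8) (Fin 8) ℤ, IsUnit P.det ∧
      P.transpose * matrixA * P = fourHyperbolic) := by
  have hdet : IsUnit (hyperbolicBasis.transpose.det * matrixA.det * hyperbolicBasis.det) := by
    rw [← det_mul, ← det_mul, hyperbolicBasis_transpose_mul_matrixA_mul]
    exact isUnit_det_of_left_inverse fourHyperbolic_mul_self
  refine ⟨fun v => ?_, isUnit_of_mul_isUnit_right (isUnit_of_mul_isUnit_left hdet), ?_,
    hyperbolicBasis, isUnit_of_mul_isUnit_right hdet, hyperbolicBasis_transpose_mul_matrixA_mul⟩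
  · rw [matrixA_eq_upper_add_transpose]
    exact even_dotProduct_add_transpose_mulVec matrixAUpper v
  · exact ⟨![1, 1, 0, 0, 0, 0, 0, 0], ![1, -1, 0, 0, 0, 0, 0, 0], by decide +kernel,
      by decide +kernel⟩
end
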